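/- Let k be an algebraically closed field and G a finite group acting on kQ by permuting the primitive idempotents and stabilizing the span of the arrows. For vertices i', j' of Q, write G_{i'j'} = G_{i'} ∩ G_{j'} and let M_{i'j'} be the span of the arrows from i' to j'. Then the multiplication in the skew group algebra (kQ)G induces an isomorphism of (G_{i'j'}, G_{i'j'})-bimodules k[G_{i'j'}] ⊗_k M_{i'j'} ≅ G_{i'j'} M_{i'j'} G_{i'j'}, where the bimodule structure on k[G_{i'j'}] ⊗_k M_{i'j'} is given by g(v ⊗ m)h = gvh ⊗ m^h for g, h ∈ G_{i'j'}, v ∈ k[G_{i'j'}], m ∈ M_{i'j'}, and G_{i'j'} M_{i'j'} G_{i'j'} ⊆ (kQ)G is the span of products gmh with g,h ∈ G_{i'j'}, m ∈ M_{i'j'}. -/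

import Mathlib

open scoped TensorProduct
open CategoryTheory

noncomputable section

universe u

/-- A right action of a group `G` on a `k`-algebra `L` by `k`-algebra automorphisms,
written `a ^ g = act.ρ g a`. -/
structure RightGAction (k : Type u) [CommRing k] (L : Type u) [Ring L] [Algebra k L]
    (G : Type u) [Group G] : Type u where
  ρ : G → L ≃ₐ[k] L
  ρ_one : ∀ a, ρ 1 a = a
  ρ_mul : ∀ g h a, ρ (g * h) a = ρ h (ρ g a)

/-- `A` is a skew group algebra `L G` for the right action `act` of `G` on `L`:
it contains `L` as a subalgebra, `G` as a subgroup of units satisfying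
`g⁻¹ * a * g = a ^ g`, and is freely spanned by the products `a * g`;
this encodes the algebra `L ⊗ₖ k[G]` with `(a ⊗ g) * (a' ⊗ g') = a * (a' ^ g⁻¹) ⊗ g g'`. -/
structure IsSkewGroupAlgebra {k L G : Type u} [CommRing k] [Ring L] [Algebra k L] [Group G]
    (act : RightGAction k L G) (A : Type u) [Ring A] [Algebra k A] : Type u where
  ι : L →ₐ[k] A
  γ : G →* Aˣ
  conj_eq : ∀ (g : G) (a : L), (↑(γ g)⁻¹ : A) * ι a * ↑(γ g) = ι (act.ρ g a)
  repr_exists : ∀ x : A, ∃ c : G →₀ L, x = c.sum fun g a => ι a * ↑(γ g)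
  repr_unique : ∀ c d : G →₀ L,
    (c.sum fun g a => ι a * ↑(γ g)) = (d.sum fun g a => ι a * ↑(γ g)) → c = d

/-- Paths in the quiver with arrow set `Arr`, source and target maps `src`, `tgt`. -/
inductive QPath {I Arr : Type u} (src tgt : Arr → I) : I → I → Type u
  | nil (i : I) : QPath src tgt i i
  | cons {i j l : I} (p : QPath src tgt i j) (a : Arr) (hs : src a = j) (ht : tgt a = l) :
      QPath src tgt i l

/-- The product, in an algebra `P`, of the arrows of a path (target-to-source order),
where `e` interprets the vertices and `arr` the arrows. -/
def pathProd {I Arr P : Type u} [Semiring P] {src tgt : Arr → I} (e : I → P) (arr : Arr → P)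
    {i j : I} (p : QPath src tgt i j) : P :=
  match i, j, p with
  | _, _, .nil i0 => e i0
  | _, _, .cons q a _ _ => arr a * pathProd e arr q

/-- `P` is the path algebra `kQ` of the quiver `Q = (I, Arr, src, tgt)`:
the vertices give a complete family of orthogonal idempotents `e i`, arrows give
elements `arr a` with `e (tgt a) * arr a * e (src a) = arr a`, and
the products of arrows along paths form a `k`-basis of `P`. -/
structure IsPathAlgebra (k : Type u) [CommRing k] {I Arr : Type u} [Fintype I]
    [DecidableEq I] (src tgt : Arr → I) (P : Type u) [Ring P] [Algebra k P] : Type u where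
  e : I → P
  arr : Arr → P
  orth : ∀ i j, e i * e j = if i = j then e i else 0
  sum_one : (∑ i, e i) = 1
  sandwich : ∀ a, e (tgt a) * arr a * e (src a) = arr a
  indep : LinearIndependent k
    (fun x : Σ i : I, Σ j : I, QPath src tgt i j => pathProd e arr x.2.2)
  span_top : Submodule.span k
    (Set.range fun x : Σ i : I, Σ j : I, QPath src tgt i j => pathProd e arr x.2.2) = ⊤

/-- An action of `G` on the path algebra `P` of a quiver permuting the primitive
idempotents (via the right action `π` on vertices) and stabilizing the span of the arrows. -/
structure ActionOnPathAlgebra (k : Type u) [CommRing k] {I Arr : Type u} [Fintype I]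
    [DecidableEq I] (src tgt : Arr → I) (P : Type u) [Ring P] [Algebra k P]
    (G : Type u) [Group G] : Type u where
  pa : IsPathAlgebra k src tgt P
  act : RightGAction k P G
  π : G → I → I
  π_one : ∀ i, π 1 i = i
  π_mul : ∀ g h i, π (g * h) i = π h (π g i)
  e_perm : ∀ g i, act.ρ g (pa.e i) = pa.e (π g i)
  arrows_stable : ∀ (g : G), ∀ x ∈ Submodule.span k (Set.range pa.arr),
    act.ρ g x ∈ Submodule.span k (Set.range pa.arr)

namespace ActionOnPathAlgebra

variable {k : Type u} [CommRing k] {I Arr : Type u} [Fintype I] [DecidableEq I]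
  {src tgt : Arr → I} {P : Type u} [Ring P] [Algebra k P] {G : Type u} [Group G]

/-- The stabilizer `G_i` of the primitive idempotent `e i`. -/
def Stab (S : ActionOnPathAlgebra k src tgt P G) (i : I) : Subgroup G where
  carrier := {g | S.π g i = i}
  one_mem' := S.π_one i
  mul_mem' := by
    intro a b ha hb
    simp only [Set.mem_setOf_eq] at *
    rw [S.π_mul, ha, hb]
  inv_mem' := by
    intro a ha
    simp only [Set.mem_setOf_eq] at *
    calc S.π a⁻¹ i = S.π a⁻¹ (S.π a i) := by rw [ha]
    _ = S.π (a * a⁻¹) i := (S.π_mul a a⁻¹ i).symm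
    _ = i := by rw [mul_inv_cancel, S.π_one]

@[simp] theorem mem_Stab (S : ActionOnPathAlgebra k src tgt P G) (i : I) (g : G) :
    g ∈ S.Stab i ↔ S.π g i = i := Iff.rfl

/-- The span `M_{i'j'}` of the arrows from `i'` to `j'`. -/
def Mij (S : ActionOnPathAlgebra k src tgt P G) (i' j' : I) : Submodule k P :=
  Submodule.span k {x | ∃ a : Arr, src a = i' ∧ tgt a = j' ∧ x = S.pa.arr a}

end ActionOnPathAlgebra

/-- Data of orbit representatives for a right action `π` of `G` on `I`:
`rep i` is the chosen representative `i∘` of the orbit of `i` and `κ i` is a group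
element with `i∘ ^ (κ i) = i`. -/
structure OrbitData {G I : Type u} [Group G] (π : G → I → I) : Type u where
  rep : I → I
  κ : I → G
  rep_rep : ∀ i, rep (rep i) = rep i
  rep_const : ∀ g i, rep (π g i) = rep i
  κ_spec : ∀ i, π (κ i) (rep i) = i

section conj

variable {k : Type u} [CommRing k] {I Arr : Type u} [Fintype I] [DecidableEq I]
  {src tgt : Arr → I} {P : Type u} [Ring P] [Algebra k P] {G : Type u} [Group G]

theorem conj_mem (S : ActionOnPathAlgebra k src tgt P G) (O : OrbitData S.π) {i' c : I}
    (hc : O.rep i' = c) {g : G} (hg : g ∈ S.Stab i') :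
    O.κ i' * g * (O.κ i')⁻¹ ∈ S.Stab c := by
  have h1 : S.π (O.κ i') c = i' := by rw [← hc]; exact O.κ_spec i'
  have hg' : S.π g i' = i' := hg
  have h2 : S.π (O.κ i' * g * (O.κ i')⁻¹) c = S.π (O.κ i')⁻¹ i' := by
    rw [S.π_mul, S.π_mul, h1, hg']
  have h3 : S.π (O.κ i')⁻¹ i' = c := by
    have h4 := S.π_mul (O.κ i') (O.κ i')⁻¹ c
    rw [mul_inv_cancel, S.π_one, h1] at h4
    exact h4.symm
  show S.π _ c = c
  rw [h2, h3]

/-- Conjugation by `κ i'`, as a group homomorphism from a subgroup `H ≤ G_{i'}`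
to the stabilizer `G_c` of the chosen representative `c` of the orbit of `i'`;
this implements the correspondence `G_{i'} = κ_{i'}⁻¹ G_{i∘} κ_{i'}`. -/
def conjHom (S : ActionOnPathAlgebra k src tgt P G) (O : OrbitData S.π) {i' c : I}
    (hc : O.rep i' = c) (H : Subgroup G) (hH : H ≤ S.Stab i') :
    H →* (S.Stab c) where
  toFun g := ⟨O.κ i' * ↑g * (O.κ i')⁻¹, conj_mem S O hc (hH g.2)⟩
  map_one' := by ext; simp
  map_mul' g h := by ext; simp only [Subgroup.coe_mul]; group

end conj

namespace IsSkewGroupAlgebra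

variable {k L G : Type u} [CommRing k] [Ring L] [Algebra k L] [Group G]
  {act : RightGAction k L G} {A : Type u} [Ring A] [Algebra k A]

theorem ι_mul_γ (sk : IsSkewGroupAlgebra act A) (g : G) (a : L) :
    sk.ι a * ↑(sk.γ g) = ↑(sk.γ g) * sk.ι (act.ρ g a) := by
  rw [← sk.conj_eq, ← mul_assoc, ← mul_assoc, Units.mul_inv, one_mul]

theorem γ_mul_ι (sk : IsSkewGroupAlgebra act A) (g : G) (a : L) :
    ↑(sk.γ g) * sk.ι a = sk.ι (act.ρ g⁻¹ a) * ↑(sk.γ g) := by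
  rw [ι_mul_γ, ← act.ρ_mul, inv_mul_cancel, act.ρ_one]

/-- The inclusion of the group algebra of a subgroup of `G` in the skew group algebra. -/
def groupAlgebraHom (sk : IsSkewGroupAlgebra act A) (H : Subgroup G) :
    MonoidAlgebra k H →ₐ[k] A :=
  MonoidAlgebra.lift k A H (((Units.coeHom A).comp sk.γ).comp H.subtype)

@[simp] theorem groupAlgebraHom_single (sk : IsSkewGroupAlgebra act A) (H : Subgroup G) (g : H) :
    sk.groupAlgebraHom H (MonoidAlgebra.single g 1) = ↑(sk.γ g) := by
  simp [groupAlgebraHom]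

/-- The multiplication map `k[H] ⊗ₖ M → A` of a skew group algebra `A`. -/
def mulMap (sk : IsSkewGroupAlgebra act A) (H : Subgroup G) (M : Submodule k L) :
    MonoidAlgebra k H ⊗[k] M →ₗ[k] A :=
  LinearMap.mul' k A ∘ₗ
    TensorProduct.map (sk.groupAlgebraHom H).toLinearMap (sk.ι.toLinearMap ∘ₗ M.subtype)

@[simp] theorem mulMap_tmul (sk : IsSkewGroupAlgebra act A) (H : Subgroup G) (M : Submodule k L)
    (v : MonoidAlgebra k H) (m : M) :
    sk.mulMap H M (v ⊗ₜ m) = sk.groupAlgebraHom H v * sk.ι m := by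
  simp [mulMap]

theorem exists_finsupp_sum_single_tmul {H M : Type*} [AddCommGroup M] [Module k M]
    (x : MonoidAlgebra k H ⊗[k] M) :
    ∃ f : H →₀ M, x = f.sum fun g m => MonoidAlgebra.single g 1 ⊗ₜ[k] m := by
  classical
  induction x using TensorProduct.induction_on with
  | zero => exact ⟨0, by simp⟩
  | add x y hx hy =>
    obtain ⟨f, rfl⟩ := hx
    obtain ⟨f', rfl⟩ := hy
    exact ⟨f + f', (Finsupp.sum_add_index' (by simp) (by simp [TensorProduct.tmul_add])).symm⟩
  | tmul v m =>
    induction v using MonoidAlgebra.induction_linear with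
    | zero => exact ⟨0, by simp⟩
    | add v w hv hw =>
      obtain ⟨f, hf⟩ := hv
      obtain ⟨f', hf'⟩ := hw
      refine ⟨f + f', ?_⟩
      rw [TensorProduct.add_tmul, hf, hf']
      exact (Finsupp.sum_add_index' (by simp) (by simp [TensorProduct.tmul_add])).symm
    | single g r =>
      refine ⟨Finsupp.single g (r • m), ?_⟩
      rw [Finsupp.sum_single_index (by simp), ← TensorProduct.smul_tmul]
      simp

theorem mulMap_injective (sk : IsSkewGroupAlgebra act A) (H : Subgroup G) (M : Submodule k L) :
    Function.Injective (sk.mulMap H M) := by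
  classical
  rw [injective_iff_map_eq_zero]
  intro x hx
  obtain ⟨f, rfl⟩ := exists_finsupp_sum_single_tmul x
  have hc : (f.sum fun g m => Finsupp.single (g : G) (act.ρ (g : G)⁻¹ (m : L))) = 0 := by
    apply sk.repr_unique
    rw [Finsupp.sum_zero_index, ← hx, map_finsuppSum,
      Finsupp.sum_sum_index (by simp) (by simp [add_mul])]
    refine Finsupp.sum_congr fun g _ => ?_
    rw [Finsupp.sum_single_index (by simp), mulMap_tmul, groupAlgebraHom_single, γ_mul_ι]
  have hf : f = 0 := by
    ext g
    have h := DFunLike.congr_fun hc (g : G)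
    simp only [Finsupp.sum_apply, Finsupp.single_apply, Subtype.coe_inj] at h
    rw [Finsupp.sum, Finset.sum_ite_eq'] at h
    simpa using h
  simp [hf]

theorem range_mulMap (sk : IsSkewGroupAlgebra act A) (H : Subgroup G) (M : Submodule k L)
    (hM : ∀ g ∈ H, ∀ m ∈ M, act.ρ g m ∈ M) :
    LinearMap.range (sk.mulMap H M) = Submodule.span k
      {x : A | ∃ g ∈ H, ∃ h ∈ H, ∃ m ∈ M, x = ↑(sk.γ g) * sk.ι m * ↑(sk.γ h)} := by
  apply le_antisymm
  · rintro _ ⟨x, rfl⟩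
    obtain ⟨f, rfl⟩ := exists_finsupp_sum_single_tmul x
    rw [map_finsuppSum]
    refine Submodule.sum_mem _ fun g _ => Submodule.subset_span ?_
    exact ⟨g, g.2, 1, H.one_mem, f g, (f g).2, by simp⟩
  · rw [Submodule.span_le]
    rintro _ ⟨g, hg, h, hh, m, hm, rfl⟩
    refine ⟨MonoidAlgebra.single (⟨g, hg⟩ * ⟨h, hh⟩) 1 ⊗ₜ ⟨act.ρ h m, hM h hh m hm⟩, ?_⟩
    rw [mulMap_tmul, groupAlgebraHom_single, mul_assoc, ι_mul_γ, ← mul_assoc]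
    simp

end IsSkewGroupAlgebra

/-- **The bimodule `G_{i'j'} M_{i'j'} G_{i'j'}`.** Let `G` act on the path algebra `kQ`
permuting the primitive idempotents and stabilizing the span of the arrows, let
`A = (kQ)G`, let `H = G_{i'j'} = G_{i'} ∩ G_{j'}` and let `M_{i'j'}` be the span of the
arrows from `i'` to `j'`. The multiplication of `A` induces an isomorphism of
`(H, H)`-bimodules `k[H] ⊗ₖ M_{i'j'} ≅ H M_{i'j'} H`, for the bimodule structure
`g (v ⊗ m) h = g v h ⊗ m ^ h` on the left hand side. -/
theorem groupAlgebra_tensor_Mij_iso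
    (k : Type u) [Field k] [IsAlgClosed k] (G : Type u) [Group G] [Fintype G]
    (I Arr : Type u) [Fintype I] [DecidableEq I] (src tgt : Arr → I)
    (P : Type u) [Ring P] [Algebra k P]
    (S : ActionOnPathAlgebra k src tgt P G)
    (A : Type u) [Ring A] [Algebra k A] (sk : IsSkewGroupAlgebra S.act A)
    (i' j' : I)
    -- the restriction to `M_{i'j'}` of the action of elements of `G_{i'} ∩ G_{j'}`
    (Mres : ∀ (g : G), g ∈ S.Stab i' → g ∈ S.Stab j' →
      (S.Mij i' j' →ₗ[k] S.Mij i' j'))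
    (Mres_spec : ∀ (g : G) (h1 : g ∈ S.Stab i') (h2 : g ∈ S.Stab j')
      (m : S.Mij i' j'), (Mres g h1 h2 m : P) = S.act.ρ g (m : P)) :
    ∀ HMH : Submodule k A,
      HMH = Submodule.span k
        {x : A | ∃ g ∈ S.Stab i' ⊓ S.Stab j', ∃ h ∈ S.Stab i' ⊓ S.Stab j',
          ∃ m ∈ S.Mij i' j', x = ↑(sk.γ g) * sk.ι m * ↑(sk.γ h)} →
      ∃ φ : (MonoidAlgebra k ↥(S.Stab i' ⊓ S.Stab j') ⊗[k] ↥(S.Mij i' j')) ≃ₗ[k] ↥HMH,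
        -- `φ` is induced by the multiplication of `A` :
        (∀ (g : ↥(S.Stab i' ⊓ S.Stab j')) (m : ↥(S.Mij i' j')),
          (φ (MonoidAlgebra.single g 1 ⊗ₜ[k] m) : A) = ↑(sk.γ ↑g) * sk.ι ↑m) ∧
        -- `φ` is an isomorphism of `(H, H)`-bimodules, for the bimodule structure
        -- `g (v ⊗ m) h = g v h ⊗ m ^ h` on the source :
        (∀ (g h : ↥(S.Stab i' ⊓ S.Stab j')) (v : MonoidAlgebra k ↥(S.Stab i' ⊓ S.Stab j'))
          (m : ↥(S.Mij i' j')),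
          (φ ((MonoidAlgebra.single g 1 * v * MonoidAlgebra.single h 1) ⊗ₜ[k]
              (Mres ↑h (Subgroup.mem_inf.mp h.2).1 (Subgroup.mem_inf.mp h.2).2 m)) : A) =
            ↑(sk.γ ↑g) * ↑(φ (v ⊗ₜ[k] m)) * ↑(sk.γ ↑h)) := by
  rintro HMH rfl
  have hM : ∀ g ∈ S.Stab i' ⊓ S.Stab j', ∀ m ∈ S.Mij i' j', S.act.ρ g m ∈ S.Mij i' j' := by
    intro g hg m hm
    rw [← Mres_spec g hg.1 hg.2 ⟨m, hm⟩]
    exact Subtype.property _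
  refine ⟨(LinearEquiv.ofInjective _ (sk.mulMap_injective _ _)).trans
    (LinearEquiv.ofEq _ _ (sk.range_mulMap _ _ hM)), fun g m => ?_, fun g h v m => ?_⟩
  · simp
  · simp only [LinearEquiv.trans_apply, LinearEquiv.coe_ofEq_apply, LinearEquiv.ofInjective_apply,
      IsSkewGroupAlgebra.mulMap_tmul, map_mul, IsSkewGroupAlgebra.groupAlgebraHom_single,
      Mres_spec, mul_assoc, sk.ι_mul_γ]
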